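/- Assume that any two distinct basic feasible solutions of Af = b have distinct cost, and let x* be the unique optimal solution of the weighted basis pursuit problem. For each e ∈ [m] let g_e : ℝ_{≥0} → ℝ_{≥0} be a strictly increasing differentiable function with g_e(1) = 1 and such that, for some α > 0, g_e(y) ≥ 1 + α(y − 1) for all y ≥ 0 and all e. Let x : [0,∞) → ℝ^m be the solution of the refined Physarum dynamics with x(0) > 0. Then x(t) → x* and |q(x(t))| → x* as t → ∞. -/

import Mathlib

open Matrix Filter Set

/-- Energy of `f` with respect to costs `c` and (positive) capacities `x`:
`E_x(f) = ∑_e (c_e/x_e) f_e²`. -/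
noncomputable def energy {m : ℕ} (c x f : Fin m → ℝ) : ℝ :=
  ∑ e, c e / x e * f e ^ 2

/-- Energy restricted to the support of `x` (for `x ≥ 0` possibly with zeros):
`∑_{e : x_e ≠ 0} (c_e/x_e) f_e²`. -/
noncomputable def energyS {m : ℕ} (c x f : Fin m → ℝ) : ℝ :=
  ∑ e, if x e = 0 then 0 else c e / x e * f e ^ 2

/-- Cost of a vector: `cᵀ|f| = ∑_e c_e |f_e|`. -/
noncomputable def costVec {m : ℕ} (c f : Fin m → ℝ) : ℝ := ∑ e, c e * |f e|

/-- `f'` is sign-compatible with `f`: `f'_e ≠ 0` implies `f'_e f_e > 0`. -/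
def SignCompat {m : ℕ} (f' f : Fin m → ℝ) : Prop :=
  ∀ e, f' e ≠ 0 → 0 < f' e * f e

/-- `f` is a basic feasible solution of `A f = b`: there is an injective choice `B`
of `n` columns such that `A_B` is invertible, `f_B = A_B⁻¹ b`, and `f` vanishes
outside `B`. -/
noncomputable def IsBFS {n m : ℕ} (A : Matrix (Fin n) (Fin m) ℝ) (b : Fin n → ℝ)
    (f : Fin m → ℝ) : Prop :=
  A.mulVec f = b ∧ ∃ B : Fin n → Fin m, Function.Injective B ∧
    IsUnit (A.submatrix id B).det ∧
    (∀ i, f (B i) = (A.submatrix id B)⁻¹.mulVec b i) ∧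
    ∀ e, (∀ i, B i ≠ e) → f e = 0

/-- The set of absolute values of determinants of square submatrices of `A`. -/
def subdetSet {n m : ℕ} (A : Matrix (Fin n) (Fin m) ℝ) : Set ℝ :=
  {d | ∃ (k : ℕ) (r : Fin k → Fin n) (s : Fin k → Fin m),
    Function.Injective r ∧ Function.Injective s ∧ d = |(A.submatrix r s).det|}

open Topology

lemma ph_dini (F : ℝ → ℝ) (k : ℝ) (hc : ContinuousOn F (Ici 0))
    (H : ∀ t ∈ Ici (0:ℝ), ∃ (h : ℝ → ℝ) (d : ℝ), h t = F t ∧ (∀ s ∈ Ici (0:ℝ), F s ≤ h s) ∧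
      HasDerivWithinAt h d (Ici 0) t ∧ d ≤ k) (a T : ℝ) (ha : 0 ≤ a) (hT : a ≤ T) :
    F T ≤ F a + k * (T - a) := by
  have key := @image_le_of_liminf_slope_right_le_deriv_boundary F a T
    (hc.mono (fun z hz => le_trans ha hz.1)) (fun s => F a + k * (s - a)) (fun _ => k) (by simp)
    (by fun_prop)
    (by
      intro z _
      have : HasDerivAt (fun s => F a + k * (s - a)) (k * 1) z :=
        (((hasDerivAt_id z).sub_const a).const_mul k).const_add (F a)
      simpa using this.hasDerivWithinAt)
  refine key ?_ ⟨hT, le_rfl⟩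
  intro z hz r hr
  have hz0 : (0:ℝ) ≤ z := le_trans ha hz.1
  obtain ⟨h, d, h1, h2, h3, h4⟩ := H z hz0
  have h5 : HasDerivWithinAt h d (Ioi z) z :=
    h3.mono (fun w hw => le_trans hz0 (le_of_lt hw))
  have h6 := (hasDerivWithinAt_iff_tendsto_slope' (by simp)).1 h5
  have h7 : ∀ᶠ w in 𝓝[>] z, slope h z w < r := h6.eventually_lt_const (lt_of_le_of_lt h4 hr)
  refine Eventually.frequently ?_
  filter_upwards [h7, self_mem_nhdsWithin] with w hw hw2
  refine lt_of_le_of_lt ?_ hw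
  have hw3 : 0 < w - z := sub_pos.2 hw2
  rw [slope_def_field, slope_def_field, h1]
  have := h2 w (le_trans hz0 (le_of_lt hw2))
  gcongr

lemma ph_lin (B a : ℝ) (h : ∀ s : ℝ, 0 ≤ 2 * s * B + s ^ 2 * a) : B = 0 := by
  have ha : 0 ≤ a := by
    have h1 := h 1; have h2 := h (-1); nlinarith
  by_contra hB
  have h1 := h (-B / (a + 1))
  have h2 : 2 * (-B / (a + 1)) * B + (-B / (a + 1)) ^ 2 * a = - (B ^ 2 * (a + 2) / (a + 1) ^ 2) := by
    field_simp; ring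
  rw [h2] at h1
  have : 0 < B ^ 2 * (a + 2) / (a + 1) ^ 2 := by positivity
  linarith

lemma ph_edge (g : ℝ → ℝ) (hgmono : StrictMonoOn g (Ici 0)) (h1 : g 1 = 1) (ε K y : ℝ)
    (hε : 0 < ε) (hε1 : ε < 1) (hK : 1 ≤ K * (1 - g (1 - ε))) (hK0 : 0 ≤ K) (hy : 0 ≤ y) :
    1 - y ^ 2 ≤ 2 * ε + K * ((g y - 1) * (y ^ 2 - 1)) := by
  rcases le_or_gt 1 y with h | h
  · have : g 1 ≤ g y := hgmono.monotoneOn (by simp) hy h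
    have h2 : 0 ≤ (g y - 1) * (y ^ 2 - 1) := mul_nonneg (by linarith) (by nlinarith)
    nlinarith [mul_nonneg hK0 h2]
  · have : g y ≤ g 1 := hgmono.monotoneOn hy (by simp) h.le
    have h2 : 0 ≤ (g y - 1) * (y ^ 2 - 1) := mul_nonneg_of_nonpos_of_nonpos (by linarith) (by nlinarith)
    have h3 := mul_nonneg hK0 h2
    rcases le_or_gt (1 - ε) y with h' | h'
    · nlinarith
    · have h4 : g y ≤ g (1 - ε) := hgmono.monotoneOn hy (by simp; linarith) h'.le
      have h5 : 1 ≤ K * (1 - g y) := hK.trans (by gcongr)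
      have h6 : 0 ≤ 1 - y ^ 2 := by nlinarith
      nlinarith [mul_le_mul_of_nonneg_right h5 h6]

lemma ph_D (g : ℝ → ℝ) (hgmono : StrictMonoOn g (Ici 0)) (h1 : g 1 = 1) (y : ℝ) (hy : 0 ≤ y) :
    0 ≤ (g y - 1) * (y ^ 2 - 1) := by
  rcases le_or_gt 1 y with h | h
  · have : g 1 ≤ g y := hgmono.monotoneOn (by simp) hy h
    exact mul_nonneg (by linarith) (by nlinarith)
  · have : g y ≤ g 1 := hgmono.monotoneOn hy (by simp) h.le
    exact mul_nonneg_of_nonpos_of_nonpos (by linarith) (by nlinarith)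

lemma ph_bfs {n m : ℕ} (A : Matrix (Fin n) (Fin m) ℝ) (b : Fin n → ℝ) (hrank : A.rank = n)
    (f : Fin m → ℝ) (hf : A.mulVec f = b)
    (hli : LinearIndepOn ℝ A.col {e | f e ≠ 0}) : IsBFS A b f := by
  refine ⟨hf, ?_⟩
  set S := hli.extend (subset_univ _) with hS
  have h1 : LinearIndepOn ℝ A.col S := hli.linearIndepOn_extend _
  have h2 : {e | f e ≠ 0} ⊆ S := hli.subset_extend _
  have h3 : Submodule.span ℝ (A.col '' S) = Submodule.span ℝ (A.col '' univ) :=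
    hli.span_image_extend_eq_span_image _
  have h4 : Module.finrank ℝ (Submodule.span ℝ (A.col '' S)) = n := by
    rw [h3, image_univ, ← rank_eq_finrank_span_cols, hrank]
  have : Fintype S := Fintype.ofFinite S
  have h5 : Fintype.card S = n := by
    rw [← h4, ← finrank_span_eq_card h1, image_eq_range]
  let φ : Fin n ≃ S := (Fintype.equivFinOfCardEq h5).symm
  let B : Fin n → Fin m := fun i => (φ i : Fin m)
  have hBi : Function.Injective B := Subtype.val_injective.comp φ.injective
  have hB : ∀ e, (∀ i, B i ≠ e) → f e = 0 := by
    intro e he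
    by_contra hne
    exact he (φ.symm ⟨e, h2 hne⟩) (by simp [B])
  have hU : IsUnit (A.submatrix id B) := by
    rw [← linearIndependent_cols_iff_isUnit]
    exact h1.linearIndependent.comp φ φ.injective
  have hd : IsUnit (A.submatrix id B).det := (isUnit_iff_isUnit_det _).1 hU
  refine ⟨B, hBi, hd, ?_, hB⟩
  have h6 : (A.submatrix id B).mulVec (f ∘ B) = b := by
    rw [← hf]
    ext i
    simp only [mulVec, dotProduct, submatrix_apply, id, Function.comp]
    rw [← Finset.sum_image (s := Finset.univ) (g := B) (f := fun e => A i e * f e)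
      (fun a _ b _ h => hBi h)]
    refine Finset.sum_subset (Finset.subset_univ _) ?_
    intro e _ he
    rw [hB e (by intro j hj; exact he (Finset.mem_image.2 ⟨j, Finset.mem_univ _, hj⟩)), mul_zero]
  intro i
  rw [← h6, mulVec_mulVec, nonsing_inv_mul _ hd, one_mulVec]
  rfl

lemma ph_cost_cont {m : ℕ} (c : Fin m → ℝ) : Continuous (costVec c) := by
  unfold costVec; fun_prop

lemma ph_compact {n m : ℕ} (A : Matrix (Fin n) (Fin m) ℝ) (b : Fin n → ℝ) (c : Fin m → ℝ)
    (hc1 : ∀ e, 1 ≤ c e) (R : ℝ) : IsCompact {f | A.mulVec f = b ∧ costVec c f ≤ R} := by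
  refine Metric.isCompact_of_isClosed_isBounded ?_ ?_
  · exact (isClosed_eq (by fun_prop) continuous_const).inter
      (isClosed_le (ph_cost_cont c) continuous_const)
  · refine (Metric.isBounded_closedBall (x := (0 : Fin m → ℝ)) (r := max R 0)).subset ?_
    rintro f ⟨-, hf⟩
    rw [mem_closedBall_zero_iff, pi_norm_le_iff_of_nonneg (le_max_right _ _)]
    intro e
    rw [Real.norm_eq_abs]
    have h0 : ∀ i ∈ Finset.univ, 0 ≤ c i * |f i| := fun i _ =>
      mul_nonneg (by linarith [hc1 i]) (abs_nonneg _)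
    have h1 : c e * |f e| ≤ costVec c f :=
      Finset.single_le_sum (f := fun i => c i * |f i|) h0 (Finset.mem_univ e)
    have h2 : |f e| ≤ c e * |f e| := le_mul_of_one_le_left (abs_nonneg _) (hc1 e)
    exact (h2.trans h1).trans (hf.trans (le_max_left _ _))

lemma ph_abs (a d : ℝ) (h : |d| ≤ |a|) : |a + d| + |a - d| = 2 * |a| := by
  rcases le_total 0 a with h1 | h1
  · rw [abs_of_nonneg h1] at *
    obtain ⟨h2, h3⟩ := abs_le.1 h
    rw [abs_of_nonneg, abs_of_nonneg] <;> linarith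
  · rw [abs_of_nonpos h1] at *
    obtain ⟨h2, h3⟩ := abs_le.1 h
    rw [abs_of_nonpos, abs_of_nonpos] <;> linarith

lemma ph_unique {n m : ℕ} (A : Matrix (Fin n) (Fin m) ℝ) (b : Fin n → ℝ) (c : Fin m → ℝ)
    (hc1 : ∀ e, 1 ≤ c e) (hrank : A.rank = n)
    (hdistinct : ∀ f g : Fin m → ℝ, IsBFS A b f → IsBFS A b g → f ≠ g →
      costVec c f ≠ costVec c g)
    (R : ℝ) (hR : ∀ f, A.mulVec f = b → R ≤ costVec c f) (f g : Fin m → ℝ)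
    (hf : A.mulVec f = b) (hfR : costVec c f ≤ R) (hg : A.mulVec g = b) (hgR : costVec c g ≤ R) :
    f = g := by
  set M : Set (Fin m → ℝ) := {f | A.mulVec f = b ∧ costVec c f ≤ R} with hM
  have hcomp : IsCompact M := ph_compact A b c hc1 R
  have hconv : Convex ℝ M := by
    rintro u ⟨hu1, hu2⟩ v ⟨hv1, hv2⟩ s t hs ht hst
    refine ⟨?_, ?_⟩
    · rw [mulVec_add, mulVec_smul, mulVec_smul, hu1, hv1, ← add_smul, hst, one_smul]
    · have : costVec c (s • u + t • v) ≤ s * costVec c u + t * costVec c v := by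
        unfold costVec
        rw [Finset.mul_sum, Finset.mul_sum, ← Finset.sum_add_distrib]
        refine Finset.sum_le_sum fun e _ => ?_
        have h1 : |s * u e + t * v e| ≤ s * |u e| + t * |v e| := by
          refine (abs_add_le _ _).trans ?_
          rw [abs_mul, abs_mul, abs_of_nonneg hs, abs_of_nonneg ht]
        simp only [Pi.add_apply, Pi.smul_apply, smul_eq_mul]
        nlinarith [mul_le_mul_of_nonneg_left h1 (by linarith [hc1 e] : (0:ℝ) ≤ c e)]
      have h8 : s * R + t * R = R := by rw [← add_mul, hst, one_mul]
      linarith [mul_le_mul_of_nonneg_left hu2 hs, mul_le_mul_of_nonneg_left hv2 ht]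
  have hext : ∀ u ∈ M.extremePoints ℝ, IsBFS A b u ∧ costVec c u = R := by
    intro u hu
    have huM : u ∈ M := hu.1
    refine ⟨?_, le_antisymm huM.2 (hR u huM.1)⟩
    refine ph_bfs A b hrank u huM.1 ?_
    by_contra hli
    -- get a dependency
    obtain ⟨d, hdS, hAd, hd0⟩ : ∃ d : Fin m → ℝ, (∀ e, u e = 0 → d e = 0) ∧ A.mulVec d = 0 ∧
        d ≠ 0 := by
      rw [linearIndepOn_iff] at hli
      push Not at hli
      obtain ⟨l, hl1, hl2, hl3⟩ := hli
      refine ⟨l, ?_, ?_, ?_⟩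
      · intro e he
        by_contra hne
        exact (hl1 (Finsupp.mem_support_iff.2 hne)) he
      · rw [Finsupp.linearCombination_apply, Finsupp.sum_fintype _ _ (by simp)] at hl2
        rw [← hl2]
        ext i
        simp [mulVec, dotProduct, mul_comm]
      · intro h; exact hl3 (by ext e; exact congrFun h e)
    obtain ⟨r, hr, hrd⟩ : ∃ r > 0, ∀ e, |r * d e| ≤ |u e| := by
      have : ∀ᶠ r in 𝓝[>] (0:ℝ), ∀ e, |r * d e| ≤ |u e| := by
        rw [eventually_all]
        intro e
        by_cases he : u e = 0
        · simp [hdS e he]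
        · have ht : Tendsto (fun r : ℝ => |r * d e|) (𝓝[>] 0) (𝓝 |0 * d e|) := by
            apply tendsto_nhdsWithin_of_tendsto_nhds
            exact (Continuous.tendsto (by fun_prop) 0)
          have hp : |0 * d e| < |u e| := by simpa using he
          filter_upwards [ht.eventually_lt_const hp] with r hr using hr.le
      obtain ⟨r, h1, h2⟩ := (this.and self_mem_nhdsWithin).exists
      exact ⟨r, h2, h1⟩
    have hA1 : A.mulVec (u + r • d) = b := by rw [mulVec_add, mulVec_smul, hAd, smul_zero, add_zero, huM.1]
    have hA2 : A.mulVec (u - r • d) = b := by rw [mulVec_sub, mulVec_smul, hAd, smul_zero, sub_zero, huM.1]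
    have hsum : costVec c (u + r • d) + costVec c (u - r • d) = 2 * costVec c u := by
      unfold costVec
      rw [Finset.mul_sum, ← Finset.sum_add_distrib]
      refine Finset.sum_congr rfl fun e _ => ?_
      have := ph_abs (u e) (r * d e) (hrd e)
      simp only [Pi.add_apply, Pi.sub_apply, Pi.smul_apply, smul_eq_mul]
      rw [← mul_add, this]; ring
    have hM1 : u + r • d ∈ M := ⟨hA1, by linarith [hR _ hA2, huM.2]⟩
    have hM2 : u - r • d ∈ M := ⟨hA2, by linarith [hR _ hA1, huM.2]⟩
    have h := hu.2 hM1 hM2 ⟨1/2, 1/2, by norm_num, by norm_num, by norm_num, by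
      ext e; simp; ring⟩
    have h0 : r • d = 0 := by simpa using h
    rcases smul_eq_zero.1 h0 with h | h
    · exact hr.ne' h
    · exact hd0 h
  have hsub : (M.extremePoints ℝ).Subsingleton := by
    intro u hu v hv
    by_contra hne
    exact hdistinct u v (hext u hu).1 (hext v hv).1 hne ((hext u hu).2.trans (hext v hv).2.symm)
  have hKM := closure_convexHull_extremePoints hcomp hconv
  have hMs : M.Subsingleton := by
    rw [← hKM]
    rcases hsub.eq_empty_or_singleton with h | ⟨v, h⟩ <;> rw [h] <;> simp
  exact hMs ⟨hf, hfR⟩ ⟨hg, hgR⟩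

lemma ph_energy_cont {n m : ℕ} (A : Matrix (Fin n) (Fin m) ℝ) (b : Fin n → ℝ) (c : Fin m → ℝ)
    (hc1 : ∀ e, 1 ≤ c e)
    (q : (Fin m → ℝ) → Fin m → ℝ)
    (hq : ∀ x : Fin m → ℝ, (∀ e, 0 < x e) →
      A.mulVec (q x) = b ∧
      ∀ f : Fin m → ℝ, A.mulVec f = b → energy c x (q x) ≤ energy c x f)
    (x : ℝ → Fin m → ℝ)
    (hpos : ∀ t ∈ Set.Ici (0 : ℝ), ∀ e, 0 < x t e)
    (hx : ∀ e, ContinuousOn (fun s => x s e) (Ici 0)) :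
    ContinuousOn (fun s => energy c (x s) (q (x s))) (Ici 0) := by
  intro t ht
  have hxt : ∀ e, Tendsto (fun s => x s e) (𝓝[Ici 0] t) (𝓝 (x t e)) := fun e => hx e t ht
  have hU : Tendsto (fun s => energy c (x s) (q (x t))) (𝓝[Ici 0] t)
      (𝓝 (energy c (x t) (q (x t)))) := by
    unfold energy
    refine tendsto_finset_sum _ fun e _ => ?_
    exact ((tendsto_const_nhds.div (hxt e) (hpos t ht e).ne').mul tendsto_const_nhds)
  have hL : Tendsto (fun s => energy c (x t) (q (x t)) / (1 + ∑ e, |x s e / x t e - 1|))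
      (𝓝[Ici 0] t) (𝓝 (energy c (x t) (q (x t)) / (1 + ∑ e, |x t e / x t e - 1|))) := by
    refine tendsto_const_nhds.div (tendsto_const_nhds.add (tendsto_finset_sum _ fun e _ => ?_)) ?_
    · exact (((hxt e).div_const _).sub_const 1).abs
    · positivity
  have hz : ∑ e, |x t e / x t e - 1| = 0 :=
    Finset.sum_eq_zero fun e _ => by rw [div_self (hpos t ht e).ne']; simp
  rw [hz, add_zero, div_one] at hL
  refine tendsto_of_tendsto_of_tendsto_of_le_of_le' hL hU ?_ ?_
  · filter_upwards [self_mem_nhdsWithin] with s hs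
    have h1 := (hq (x t) (hpos t ht)).2 (q (x s)) (hq (x s) (hpos s hs)).1
    have h0 : 0 ≤ ∑ e, |x s e / x t e - 1| := Finset.sum_nonneg fun e _ => abs_nonneg _
    rw [div_le_iff₀ (by linarith)]
    refine h1.trans ?_
    unfold energy
    rw [Finset.sum_mul]
    refine Finset.sum_le_sum fun e _ => ?_
    have h2 : |x s e / x t e - 1| ≤ ∑ e, |x s e / x t e - 1| :=
      Finset.single_le_sum (f := fun e => |x s e / x t e - 1|) (fun e _ => abs_nonneg _)
        (Finset.mem_univ e)
    have h3 : x s e / x t e ≤ 1 + ∑ e, |x s e / x t e - 1| := by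
      linarith [le_abs_self (x s e / x t e - 1)]
    have hp1 := hpos t ht e
    have hp2 := hpos s hs e
    have hc0 : 0 < c e := by linarith [hc1 e]
    calc c e / x t e * q (x s) e ^ 2 = c e / x s e * q (x s) e ^ 2 * (x s e / x t e) := by
          field_simp
      _ ≤ _ := by gcongr
  · filter_upwards [self_mem_nhdsWithin] with s hs
    exact (hq (x s) (hpos s hs)).2 (q (x t)) (hq (x t) (hpos t ht)).1

/-- First-order optimality. -/
lemma ph_first {n m : ℕ} (A : Matrix (Fin n) (Fin m) ℝ) (b : Fin n → ℝ) (c x p f : Fin m → ℝ)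
    (hp : A.mulVec p = b) (hf : A.mulVec f = b)
    (hmin : ∀ f : Fin m → ℝ, A.mulVec f = b → energy c x p ≤ energy c x f) :
    energy c x p = ∑ e, c e / x e * (p e * f e) := by
  have h : ∑ e, c e / x e * (p e * (f e - p e)) = 0 := by
    apply ph_lin _ (energy c x (f - p))
    intro s
    have h1 : A.mulVec (p + s • (f - p)) = b := by
      rw [mulVec_add, mulVec_smul, mulVec_sub, hp, hf]; simp
    have h2 := hmin _ h1
    have h3 : energy c x (p + s • (f - p)) = energy c x p +
        (2 * s * (∑ e, c e / x e * (p e * (f e - p e))) + s ^ 2 * energy c x (f - p)) := by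
      unfold energy
      rw [Finset.mul_sum, Finset.mul_sum, ← Finset.sum_add_distrib, ← Finset.sum_add_distrib]
      refine Finset.sum_congr rfl fun e _ => ?_
      simp only [Pi.add_apply, Pi.smul_apply, Pi.sub_apply, smul_eq_mul]
      ring
    linarith
  have h2 : ∑ e, c e / x e * (p e * f e) - energy c x p
      = ∑ e, c e / x e * (p e * (f e - p e)) := by
    unfold energy
    rw [← Finset.sum_sub_distrib]
    exact Finset.sum_congr rfl fun e _ => by ring
  linarith

/-- lower bound of the Lyapunov function -/
lemma ph_lyap {m : ℕ} (c x f : Fin m → ℝ) (hx : ∀ e, 0 < x e) :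
    ∑ e, c e * x e + energy c x f =
      2 * costVec c f + ∑ e, c e * (x e - |f e|) ^ 2 / x e := by
  unfold energy costVec
  rw [Finset.mul_sum, ← Finset.sum_add_distrib, ← Finset.sum_add_distrib]
  refine Finset.sum_congr rfl fun e _ => ?_
  have := hx e
  rw [← sq_abs (f e)]
  field_simp
  ring

lemma ph_main {n m : ℕ}
    (A : Matrix (Fin n) (Fin m) ℝ) (b : Fin n → ℝ) (c : Fin m → ℝ)
    (hc1 : ∀ e, 1 ≤ c e)
    (fs : Fin m → ℝ) (hfs : A.mulVec fs = b)
    (q : (Fin m → ℝ) → Fin m → ℝ)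
    (hq : ∀ x : Fin m → ℝ, (∀ e, 0 < x e) →
      A.mulVec (q x) = b ∧
      ∀ f : Fin m → ℝ, A.mulVec f = b → energy c x (q x) ≤ energy c x f)
    (g : Fin m → ℝ → ℝ)
    (hgmono : ∀ e, StrictMonoOn (g e) (Set.Ici (0 : ℝ)))
    (hg1 : ∀ e, g e 1 = 1)
    (α : ℝ) (hα : 0 < α)
    (hglin : ∀ e, ∀ y ∈ Set.Ici (0 : ℝ), 1 + α * (y - 1) ≤ g e y)
    (x : ℝ → Fin m → ℝ)
    (hpos : ∀ t ∈ Set.Ici (0 : ℝ), ∀ e, 0 < x t e)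
    (hdyn : ∀ t ∈ Set.Ici (0 : ℝ), ∀ e, HasDerivWithinAt (fun s => x s e)
      (x t e * (g e (|q (x t) e| / x t e) - 1)) (Set.Ici 0) t) :
    (∀ a t, 0 ≤ a → a ≤ t → ∑ e, c e * x t e + energy c (x t) (q (x t)) ≤
      ∑ e, c e * x a e + energy c (x a) (q (x a))) ∧
    ∀ η > 0, ∃ t ≥ (0:ℝ), ∑ e, c e * x t e + energy c (x t) (q (x t)) < 2 * costVec c fs + η := by
  have hxc : ∀ e, ContinuousOn (fun s => x s e) (Ici 0) :=
    fun e t ht => (hdyn t ht e).continuousWithinAt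
  have hEc := ph_energy_cont A b c hc1 q hq x hpos hxc
  have hc0 : ∀ e, 0 < c e := fun e => by linarith [hc1 e]
  set L : ℝ → ℝ := fun t => ∑ e, c e * x t e + energy c (x t) (q (x t)) with hL
  set y : ℝ → Fin m → ℝ := fun t e => |q (x t) e| / x t e with hy
  set D : ℝ → ℝ := fun t => ∑ e, c e * x t e * ((g e (y t e) - 1) * (y t e ^ 2 - 1)) with hD
  have hy0 : ∀ t ∈ Ici (0:ℝ), ∀ e, 0 ≤ y t e := fun t ht e =>
    div_nonneg (abs_nonneg _) (hpos t ht e).le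
  have hLc : ContinuousOn L (Ici 0) :=
    (continuousOn_finset_sum _ fun e _ => continuousOn_const.mul (hxc e)).add hEc
  have hD0 : ∀ t ∈ Ici (0:ℝ), 0 ≤ D t := fun t ht => Finset.sum_nonneg fun e _ =>
    mul_nonneg (mul_nonneg (hc0 e).le (hpos t ht e).le) (ph_D _ (hgmono e) (hg1 e) _ (hy0 t ht e))
  have hE0 : ∀ t ∈ Ici (0:ℝ), 0 ≤ energy c (x t) (q (x t)) := fun t ht =>
    Finset.sum_nonneg fun e _ => mul_nonneg (div_nonneg (hc0 e).le (hpos t ht e).le) (sq_nonneg _)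
  -- the majorant
  have hmaj : ∀ t ∈ Ici (0:ℝ), HasDerivWithinAt
      (fun s => ∑ e, c e * x s e + energy c (x s) (q (x t))) (- D t) (Ici 0) t := by
    intro t ht
    have h1 : HasDerivWithinAt (fun s => ∑ e, (c e * x s e + c e / x s e * q (x t) e ^ 2))
        (∑ e, -(c e * x t e * ((g e (y t e) - 1) * (y t e ^ 2 - 1)))) (Ici 0) t := by
      refine HasDerivWithinAt.fun_sum fun e _ => ?_
      have hp := hpos t ht e
      have h2 := hdyn t ht e
      have h3 := ((hasDerivWithinAt_const t (Ici 0) (c e)).fun_div h2 hp.ne').mul_const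
        (q (x t) e ^ 2)
      refine ((h2.const_mul (c e)).fun_add h3).congr_deriv ?_
      simp only [hy]
      rw [← sq_abs (q (x t) e)]
      generalize g e (|q (x t) e| / x t e) = G
      field_simp
      ring
    rw [Finset.sum_neg_distrib] at h1
    simpa only [energy, Finset.sum_add_distrib] using h1
  have hmajle : ∀ t ∈ Ici (0:ℝ), ∀ s ∈ Ici (0:ℝ),
      L s ≤ ∑ e, c e * x s e + energy c (x s) (q (x t)) := by
    intro t ht s hs
    have := (hq (x s) (hpos s hs)).2 (q (x t)) (hq (x t) (hpos t ht)).1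
    simp only [hL]; linarith
  have hanti : ∀ a t, 0 ≤ a → a ≤ t → L t ≤ L a := by
    intro a t ha hat
    have := ph_dini L 0 hLc (fun t ht => ⟨fun s => ∑ e, c e * x s e + energy c (x s) (q (x t)), -D t, rfl,
      hmajle t ht, hmaj t ht,
      by linarith [hD0 t ht]⟩) a t ha hat
    linarith
  refine ⟨hanti, ?_⟩
  intro η hη
  by_contra hcon
  push Not at hcon
  have hL0 : 0 ≤ L 0 := add_nonneg (Finset.sum_nonneg fun e _ =>
    mul_nonneg (hc0 e).le (hpos 0 (by simp) e).le) (hE0 0 (by simp))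
  have hcx : ∀ t ∈ Ici (0:ℝ), ∑ e, c e * x t e ≤ L 0 := fun t ht => by
    have h1 := hanti 0 t le_rfl ht
    have h2 := hE0 t ht
    have h3 : L t = ∑ e, c e * x t e + energy c (x t) (q (x t)) := rfl
    linarith
  have hxb : ∀ t ∈ Ici (0:ℝ), ∀ e, x t e ≤ L 0 := fun t ht e => by
    have h1 : c e * x t e ≤ ∑ e, c e * x t e :=
      Finset.single_le_sum (f := fun e => c e * x t e)
        (fun e _ => mul_nonneg (hc0 e).le (hpos t ht e).le) (Finset.mem_univ e)
    have h2 := hcx t ht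
    have h3 : x t e ≤ c e * x t e := le_mul_of_one_le_left (hpos t ht e).le (hc1 e)
    linarith
  -- choose ε, K
  obtain ⟨ε, hε, hε1, hεL⟩ : ∃ ε : ℝ, 0 < ε ∧ ε < 1 ∧ 2 * ε * L 0 ≤ η / 2 := by
    refine ⟨η / (η + 4 * L 0 + 1), by positivity, ?_, ?_⟩
    · rw [div_lt_one (by positivity)]; linarith
    · rw [show 2 * (η / (η + 4 * L 0 + 1)) * L 0 = (2 * η * L 0) / (η + 4 * L 0 + 1) by ring]
      rw [div_le_iff₀ (by positivity)]
      nlinarith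
  have hδ : ∀ e, 0 < 1 - g e (1 - ε) := fun e => by
    have := hgmono e (a := 1 - ε) (b := 1) (by simp; linarith) (by simp) (by linarith)
    linarith [hg1 e]
  set K : ℝ := ∑ e, (1 - g e (1 - ε))⁻¹ with hK
  have hK0 : 0 ≤ K := Finset.sum_nonneg fun e _ => (inv_pos.2 (hδ e)).le
  have hK1 : ∀ e, 1 ≤ K * (1 - g e (1 - ε)) := fun e => by
    have h1 : (1 - g e (1 - ε))⁻¹ ≤ K :=
      Finset.single_le_sum (f := fun e => (1 - g e (1 - ε))⁻¹)
        (fun e _ => (inv_pos.2 (hδ e)).le) (Finset.mem_univ e)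
    have h2 := mul_le_mul_of_nonneg_right h1 (hδ e).le
    rwa [inv_mul_cancel₀ (hδ e).ne'] at h2
  have hgap : ∀ t ∈ Ici (0:ℝ), ∑ e, c e * x t e - energy c (x t) (q (x t)) ≤
      2 * ε * L 0 + K * D t := by
    intro t ht
    have h1 : ∑ e, c e * x t e - energy c (x t) (q (x t)) ≤
        2 * ε * (∑ e, c e * x t e) + K * D t := by
      simp only [hD, energy]
      rw [Finset.mul_sum, Finset.mul_sum, ← Finset.sum_sub_distrib, ← Finset.sum_add_distrib]
      refine Finset.sum_le_sum fun e _ => ?_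
      have hp := hpos t ht e
      have h2 := ph_edge (g e) (hgmono e) (hg1 e) ε K (y t e) hε hε1 (hK1 e) hK0 (hy0 t ht e)
      have h3 := mul_le_mul_of_nonneg_left h2 (mul_nonneg (hc0 e).le hp.le)
      have h4 : c e / x t e * q (x t) e ^ 2 = c e * x t e * y t e ^ 2 := by
        simp only [hy]
        rw [← sq_abs (q (x t) e)]
        field_simp
      rw [h4]
      linarith
    have h2 := mul_le_mul_of_nonneg_left (hcx t ht) (by linarith : 0 ≤ 2 * ε)
    linarith
  set V : ℝ → ℝ := fun t => ∑ e, c e * |fs e| * Real.log (x t e) with hV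
  have hVd : ∀ t ∈ Ici (0:ℝ), HasDerivWithinAt V
      (∑ e, c e * |fs e| * (g e (y t e) - 1)) (Ici 0) t := by
    intro t ht
    refine HasDerivWithinAt.fun_sum fun e _ => ?_
    have hp := hpos t ht e
    refine (((hdyn t ht e).log hp.ne').const_mul (c e * |fs e|)).congr_deriv ?_
    simp only [hy]
    field_simp
  have hVlow : ∀ t ∈ Ici (0:ℝ), α * (energy c (x t) (q (x t)) - costVec c fs) ≤
      ∑ e, c e * |fs e| * (g e (y t e) - 1) := by
    intro t ht
    rw [ph_first A b c (x t) (q (x t)) fs (hq _ (hpos t ht)).1 hfs (hq _ (hpos t ht)).2]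
    unfold costVec
    rw [← Finset.sum_sub_distrib, Finset.mul_sum]
    refine Finset.sum_le_sum fun e _ => ?_
    have hp := hpos t ht e
    have h1 := hglin e (y t e) (hy0 t ht e)
    have h2 : c e / x t e * (q (x t) e * fs e) ≤ c e * |fs e| * y t e := by
      have h3 : c e * |fs e| * y t e = c e / x t e * |q (x t) e * fs e| := by
        simp only [hy]; rw [abs_mul]; field_simp
      rw [h3]
      exact mul_le_mul_of_nonneg_left (le_abs_self _) (div_nonneg (hc0 e).le hp.le)
    have h4 : 0 ≤ c e * |fs e| := mul_nonneg (hc0 e).le (abs_nonneg _)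
    calc _ ≤ α * (c e * |fs e| * y t e - c e * |fs e|) := by gcongr
      _ = c e * |fs e| * (α * (y t e - 1)) := by ring
      _ ≤ _ := by gcongr; linarith
  have hVb : ∀ t ∈ Ici (0:ℝ), V t ≤ costVec c fs * L 0 := by
    intro t ht
    unfold costVec
    rw [Finset.sum_mul]
    refine Finset.sum_le_sum fun e _ => ?_
    have h4 : 0 ≤ c e * |fs e| := mul_nonneg (hc0 e).le (abs_nonneg _)
    have h5 := Real.log_le_sub_one_of_pos (hpos t ht e)
    have h6 := hxb t ht e
    gcongr
    linarith
  set F : ℝ → ℝ := fun t => K * L t - 2 / α * V t with hF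
  have hVc : ContinuousOn V (Ici 0) := fun t ht => (hVd t ht).continuousWithinAt
  have hFc : ContinuousOn F (Ici 0) :=
    (continuousOn_const.mul hLc).sub (continuousOn_const.mul hVc)
  have hdecr : ∀ T, 0 ≤ T → F T ≤ F 0 + (-(η/2)) * (T - 0) := by
    intro T hT
    refine ph_dini F _ hFc ?_ 0 T le_rfl hT
    intro t ht
    refine ⟨fun s => K * (∑ e, c e * x s e + energy c (x s) (q (x t))) - 2 / α * V s, _, rfl, ?_,
      ((hmaj t ht).const_mul K).fun_sub ((hVd t ht).const_mul (2 / α)), ?_⟩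
    · intro s hs
      have := mul_le_mul_of_nonneg_left (hmajle t ht s hs) hK0
      simp only [hF]; linarith
    · have h1 := mul_le_mul_of_nonneg_left (hVlow t ht) (by positivity : 0 ≤ 2 / α)
      rw [← mul_assoc, div_mul_cancel₀ _ hα.ne'] at h1
      have h2 := hgap t ht
      have h3 := hcon t ht
      linarith
  have hlow : ∀ T, 0 ≤ T → - (2 / α * (costVec c fs * L 0)) ≤ F T := by
    intro T hT
    have h1 := mul_le_mul_of_nonneg_left (hVb T hT) (by positivity : 0 ≤ 2 / α)
    have h2 : 0 ≤ L T := add_nonneg (Finset.sum_nonneg fun e _ =>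
      mul_nonneg (hc0 e).le (hpos T hT e).le) (hE0 T hT)
    have h3 := mul_nonneg hK0 h2
    simp only [hF]; linarith
  set Q := F 0 + 2 / α * (costVec c fs * L 0) with hQ
  have hbad : ∀ T, 0 ≤ T → η / 2 * T ≤ Q := fun T hT => by
    have h1 := hdecr T hT
    have h2 := hlow T hT
    linarith
  have hQ0 : 0 ≤ Q := by have := hbad 0 le_rfl; linarith
  have h9 := hbad ((Q + 1) * (2 / η)) (by positivity)
  have h10 : η / 2 * ((Q + 1) * (2 / η)) = Q + 1 := by field_simp
  linarith

/-- If in addition `g_e(y) ≥ 1 + α(y − 1)` for some `α > 0`, the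
solution of the refined Physarum dynamics converges to the optimum `x*` of the
weighted basis pursuit problem, and so does `|q(x(t))|`. -/
theorem refined_physarum_converges_to_optimum {n m : ℕ} (hnm : n ≤ m)
    (A : Matrix (Fin n) (Fin m) ℝ) (b : Fin n → ℝ) (c : Fin m → ℝ)
    (hAZ : ∀ i j, ∃ z : ℤ, A i j = (z : ℝ))
    (hbZ : ∀ i, ∃ z : ℤ, b i = (z : ℝ))
    (hcZ : ∀ e, ∃ z : ℤ, c e = (z : ℝ))
    (hc1 : ∀ e, 1 ≤ c e)
    (hrank : A.rank = n)
    (hfeas : ∃ f : Fin m → ℝ, A.mulVec f = b)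
    (hdistinct : ∀ f g : Fin m → ℝ, IsBFS A b f → IsBFS A b g → f ≠ g →
      costVec c f ≠ costVec c g)
    (xstar : Fin m → ℝ)
    (hopt : ∃ fstar : Fin m → ℝ, A.mulVec fstar = b ∧ (∀ e, |fstar e| ≤ xstar e) ∧
      ∀ (f y : Fin m → ℝ), A.mulVec f = b → (∀ e, |f e| ≤ y e) →
        ∑ e, c e * xstar e ≤ ∑ e, c e * y e)
    (q : (Fin m → ℝ) → Fin m → ℝ)
    (hq : ∀ x : Fin m → ℝ, (∀ e, 0 < x e) →
      A.mulVec (q x) = b ∧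
      ∀ f : Fin m → ℝ, A.mulVec f = b → energy c x (q x) ≤ energy c x f)
    (g : Fin m → ℝ → ℝ)
    (hg0 : ∀ e, ∀ y ∈ Set.Ici (0 : ℝ), 0 ≤ g e y)
    (hgmono : ∀ e, StrictMonoOn (g e) (Set.Ici (0 : ℝ)))
    (hgdiff : ∀ e, DifferentiableOn ℝ (g e) (Set.Ici (0 : ℝ)))
    (hg1 : ∀ e, g e 1 = 1)
    (α : ℝ) (hα : 0 < α)
    (hglin : ∀ e, ∀ y ∈ Set.Ici (0 : ℝ), 1 + α * (y - 1) ≤ g e y)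
    (x : ℝ → Fin m → ℝ) (hx₀ : ∀ e, 0 < x 0 e)
    (hpos : ∀ t ∈ Set.Ici (0 : ℝ), ∀ e, 0 < x t e)
    (hdyn : ∀ t ∈ Set.Ici (0 : ℝ), ∀ e, HasDerivWithinAt (fun s => x s e)
      (x t e * (g e (|q (x t) e| / x t e) - 1)) (Set.Ici 0) t) :
    Tendsto x atTop (nhds xstar) ∧
    Tendsto (fun t => fun e => |q (x t) e|) atTop (nhds xstar) := by
  obtain ⟨fs, hfs, hfx, hmin⟩ := hopt
  have hc0 : ∀ e, 0 < c e := fun e => by linarith [hc1 e]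
  have hxs : xstar = fun e => |fs e| := by
    have h1 := hmin fs (fun e => |fs e|) hfs (fun e => le_rfl)
    have h2 : ∀ e ∈ Finset.univ, c e * |fs e| ≤ c e * xstar e := fun e _ =>
      mul_le_mul_of_nonneg_left (hfx e) (hc0 e).le
    have h3 := (Finset.sum_eq_sum_iff_of_le h2).1 (le_antisymm (Finset.sum_le_sum h2) h1)
    ext e
    exact (mul_left_cancel₀ (hc0 e).ne' (h3 e (Finset.mem_univ e))).symm
  have hopt' : ∀ f, A.mulVec f = b → costVec c fs ≤ costVec c f := by
    intro f hf
    have := hmin f (fun e => |f e|) hf (fun e => le_rfl)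
    rw [hxs] at this
    exact this
  obtain ⟨hanti, hsmall⟩ := ph_main A b c hc1 fs hfs q hq g hgmono hg1 α hα hglin x hpos hdyn
  set L : ℝ → ℝ := fun t => ∑ e, c e * x t e + energy c (x t) (q (x t)) with hL
  set S : ℝ → ℝ := fun t => ∑ e, c e * (x t e - |q (x t) e|) ^ 2 / x t e with hS
  have hS0 : ∀ t ∈ Ici (0:ℝ), ∀ e ∈ Finset.univ,
      0 ≤ c e * (x t e - |q (x t) e|) ^ 2 / x t e := fun t ht e _ =>
    div_nonneg (mul_nonneg (hc0 e).le (sq_nonneg _)) (hpos t ht e).le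
  have hLS : ∀ t ∈ Ici (0:ℝ), L t = 2 * costVec c (q (x t)) + S t := fun t ht =>
    ph_lyap c (x t) (q (x t)) (hpos t ht)
  have hev : ∀ η > 0, ∀ᶠ t in atTop, 0 ≤ t ∧ costVec c (q (x t)) ≤ costVec c fs + η ∧ S t ≤ η := by
    intro η hη
    obtain ⟨t₀, ht₀, h1⟩ := hsmall η hη
    filter_upwards [eventually_ge_atTop t₀] with t ht
    have ht0 : 0 ≤ t := le_trans ht₀ ht
    have h2 : L t ≤ L t₀ := hanti t₀ t ht₀ ht
    have h3 := hLS t ht0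
    have h4 : 0 ≤ S t := Finset.sum_nonneg (hS0 t ht0)
    have h5 := hopt' _ (hq _ (hpos t ht0)).1
    have h6 : L t₀ < 2 * costVec c fs + η := h1
    exact ⟨ht0, by linarith, by linarith⟩
  have hqlim : Tendsto (fun t => q (x t)) atTop (nhds fs) := by
    refine (ph_compact A b c hc1 (costVec c fs + 1)).tendsto_nhds_of_unique_mapClusterPt
      (y := fs) ?_ ?_
    · filter_upwards [hev 1 one_pos] with t ht
      exact ⟨(hq _ (hpos t ht.1)).1, ht.2.1⟩
    · rintro z ⟨hz1, -⟩ hz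
      refine ph_unique A b c hc1 hrank hdistinct (costVec c fs) hopt' z fs hz1 ?_ hfs le_rfl
      refine le_of_forall_pos_le_add fun η hη => ?_
      have hcl : IsClosed {f : Fin m → ℝ | costVec c f ≤ costVec c fs + η} :=
        isClosed_le (ph_cost_cont c) continuous_const
      refine hcl.mem_of_mapClusterPt hz ?_
      filter_upwards [hev η hη] with t ht using ht.2.1
  have hq2 : Tendsto (fun t => fun e => |q (x t) e|) atTop (nhds xstar) := by
    rw [hxs, tendsto_pi_nhds]
    intro e
    exact ((tendsto_pi_nhds.1 hqlim) e).abs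
  refine ⟨?_, hq2⟩
  have hdiff : ∀ e, Tendsto (fun t => (x t e - |q (x t) e|) ^ 2) atTop (nhds 0) := by
    intro e
    have hL0 : 0 ≤ L 0 := by
      have h1 := hLS 0 (by simp)
      have h2 : 0 ≤ S 0 := Finset.sum_nonneg (hS0 0 (by simp))
      have h3 : 0 ≤ costVec c (q (x 0)) := Finset.sum_nonneg fun e _ =>
        mul_nonneg (hc0 e).le (abs_nonneg _)
      linarith
    have hb : ∀ t ∈ Ici (0:ℝ), (x t e - |q (x t) e|) ^ 2 ≤ L 0 * S t := by
      intro t ht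
      have hp := hpos t ht e
      have h1 : c e * x t e ≤ ∑ e, c e * x t e :=
        Finset.single_le_sum (f := fun e => c e * x t e)
          (fun e _ => mul_nonneg (hc0 e).le (hpos t ht e).le) (Finset.mem_univ e)
      have h2 : 0 ≤ energy c (x t) (q (x t)) :=
        Finset.sum_nonneg fun e _ => mul_nonneg (div_nonneg (hc0 e).le (hpos t ht e).le) (sq_nonneg _)
      have h3 : x t e ≤ c e * x t e := le_mul_of_one_le_left hp.le (hc1 e)
      have h4 : L t ≤ L 0 := hanti 0 t le_rfl ht
      have h5 : L t = ∑ e, c e * x t e + energy c (x t) (q (x t)) := rfl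
      have h6 : x t e ≤ L 0 := by linarith
      have h7 : c e * (x t e - |q (x t) e|) ^ 2 / x t e ≤ S t :=
        Finset.single_le_sum (hS0 t ht) (Finset.mem_univ e)
      calc (x t e - |q (x t) e|) ^ 2 ≤ c e * (x t e - |q (x t) e|) ^ 2 :=
            le_mul_of_one_le_left (sq_nonneg _) (hc1 e)
        _ = x t e * (c e * (x t e - |q (x t) e|) ^ 2 / x t e) := by field_simp
        _ ≤ L 0 * S t := mul_le_mul h6 h7 (hS0 t ht e (Finset.mem_univ e)) hL0
    rw [Metric.tendsto_nhds]
    intro η hη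
    filter_upwards [hev (η / (L 0 + 1)) (by positivity)] with t ht
    have h1 := hb t ht.1
    rw [Real.dist_eq, sub_zero, abs_of_nonneg (sq_nonneg _)]
    have h2 := mul_le_mul_of_nonneg_left ht.2.2 hL0
    have h3 : L 0 * (η / (L 0 + 1)) < η := by
      rw [mul_div_assoc', div_lt_iff₀ (by positivity)]
      nlinarith
    linarith
  rw [tendsto_pi_nhds]
  intro e
  have h1 : Tendsto (fun t => x t e - |q (x t) e|) atTop (nhds 0) := by
    have := (hdiff e).sqrt
    simp only [Real.sqrt_sq_eq_abs, Real.sqrt_zero] at this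
    exact (tendsto_zero_iff_abs_tendsto_zero _).2 this
  have h2 := h1.add ((tendsto_pi_nhds.1 hq2) e)
  simpa using h2
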